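/- The 4-dimensional exterior superalgebra A = K⟨x,y⟩/(x², y², xy + yx) with grading A₀ = span{1, x} and A₁ = span{y, xy} admits no superbialgebra structure: there exist no grading-preserving K-linear maps Δ : A → A ⊗ A and ε : A → K making this superalgebra into a superbialgebra. -/

import Mathlib

open TensorProduct

section SuperDefs

variable (K A : Type*) [Field K] [Ring A] [Algebra K A]

/-- A superalgebra structure on the unital associative `K`-algebra `A`: a `ℤ/2ℤ`-grading
`A = A₀ ⊕ A₁` of `K`-vector spaces with `1 ∈ A₀` and `Aᵢ · Aⱼ ⊆ A_{i+j mod 2}`. -/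
structure SuperAlgebra where
  A₀ : Submodule K A
  A₁ : Submodule K A
  compl : IsCompl A₀ A₁
  one_mem : (1 : A) ∈ A₀
  mul_mem₀₀ : ∀ a ∈ A₀, ∀ b ∈ A₀, a * b ∈ A₀
  mul_mem₀₁ : ∀ a ∈ A₀, ∀ b ∈ A₁, a * b ∈ A₁
  mul_mem₁₀ : ∀ a ∈ A₁, ∀ b ∈ A₀, a * b ∈ A₁
  mul_mem₁₁ : ∀ a ∈ A₁, ∀ b ∈ A₁, a * b ∈ A₀

namespace SuperAlgebra

variable {K A}

/-- The projection onto the even part along the odd part. -/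
noncomputable def p₀ (S : SuperAlgebra K A) : A →ₗ[K] A :=
  S.A₀.subtype ∘ₗ Submodule.linearProjOfIsCompl S.A₀ S.A₁ S.compl

/-- The projection onto the odd part along the even part. -/
noncomputable def p₁ (S : SuperAlgebra K A) : A →ₗ[K] A :=
  S.A₁.subtype ∘ₗ Submodule.linearProjOfIsCompl S.A₁ S.A₀ S.compl.symm

/-- The superflip `τ : A ⊗ A → A ⊗ A`, `a ⊗ b ↦ (-1)^{|a||b|} b ⊗ a` on homogeneous
elements. -/
noncomputable def τ (S : SuperAlgebra K A) : A ⊗[K] A →ₗ[K] A ⊗[K] A :=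
  (TensorProduct.comm K A A).toLinearMap ∘ₗ
    (TensorProduct.map S.p₀ S.p₀ + TensorProduct.map S.p₀ S.p₁ +
      TensorProduct.map S.p₁ S.p₀ - TensorProduct.map S.p₁ S.p₁)

variable (K A) in
/-- Regrouping `(A ⊗ A) ⊗ (A ⊗ A) ≃ A ⊗ ((A ⊗ A) ⊗ A)`. -/
noncomputable def rearr : ((A ⊗[K] A) ⊗[K] (A ⊗[K] A)) ≃ₗ[K] (A ⊗[K] ((A ⊗[K] A) ⊗[K] A)) :=
  (TensorProduct.assoc K A A (A ⊗[K] A)) ≪≫ₗ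
    TensorProduct.congr (LinearEquiv.refl K A) (TensorProduct.assoc K A A A).symm

/-- The map `(μ ⊗ μ) ∘ (id ⊗ τ ⊗ id) : (A ⊗ A) ⊗ (A ⊗ A) → A ⊗ A`, i.e. the super
multiplication of `A ⊗ A`. -/
noncomputable def superBimul (S : SuperAlgebra K A) :
    ((A ⊗[K] A) ⊗[K] (A ⊗[K] A)) →ₗ[K] A ⊗[K] A :=
  TensorProduct.map (LinearMap.mul' K A) (LinearMap.mul' K A) ∘ₗ
    (rearr K A).symm.toLinearMap ∘ₗ
    TensorProduct.map (LinearMap.id : A →ₗ[K] A)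
      (TensorProduct.map S.τ (LinearMap.id : A →ₗ[K] A)) ∘ₗ
    (rearr K A).toLinearMap

/-- The even part of `A ⊗ A` for the total grading. -/
def evenTensor (S : SuperAlgebra K A) : Submodule K (A ⊗[K] A) :=
  LinearMap.range (TensorProduct.map S.A₀.subtype S.A₀.subtype) ⊔
    LinearMap.range (TensorProduct.map S.A₁.subtype S.A₁.subtype)

/-- The odd part of `A ⊗ A` for the total grading. -/
def oddTensor (S : SuperAlgebra K A) : Submodule K (A ⊗[K] A) :=
  LinearMap.range (TensorProduct.map S.A₀.subtype S.A₁.subtype) ⊔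
    LinearMap.range (TensorProduct.map S.A₁.subtype S.A₀.subtype)

end SuperAlgebra

/-- A superbialgebra over `K`: a superalgebra together with grading-preserving linear maps
`Δ : A → A ⊗ A` and `ε : A → K` satisfying coassociativity, counity, and compatibility
with the (super)algebra structure. -/
structure SuperBialgebra extends SuperAlgebra K A where
  Δ : A →ₗ[K] A ⊗[K] A
  ε : A →ₗ[K] K
  Δ_even : ∀ a ∈ A₀, Δ a ∈ toSuperAlgebra.evenTensor
  Δ_odd : ∀ a ∈ A₁, Δ a ∈ toSuperAlgebra.oddTensor
  ε_odd : ∀ a ∈ A₁, ε a = 0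
  coassoc : ∀ a : A,
    TensorProduct.assoc K A A A (TensorProduct.map Δ (LinearMap.id : A →ₗ[K] A) (Δ a)) =
      TensorProduct.map (LinearMap.id : A →ₗ[K] A) Δ (Δ a)
  counit_left : ∀ a : A,
    TensorProduct.lid K A (TensorProduct.map ε (LinearMap.id : A →ₗ[K] A) (Δ a)) = a
  counit_right : ∀ a : A,
    TensorProduct.rid K A (TensorProduct.map (LinearMap.id : A →ₗ[K] A) ε (Δ a)) = a
  Δ_one : Δ 1 = 1 ⊗ₜ[K] 1
  ε_one : ε 1 = 1
  ε_mul : ∀ a b : A, ε (a * b) = ε a * ε b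
  Δ_mul : ∀ a b : A, Δ (a * b) = toSuperAlgebra.superBimul (Δ a ⊗ₜ[K] Δ b)

/-- A Hopf superalgebra: a superbialgebra with a grading-preserving antipode `S`
satisfying `μ ∘ (S ⊗ id) ∘ Δ = μ ∘ (id ⊗ S) ∘ Δ = η ∘ ε`. -/
structure HopfSuperalgebra extends SuperBialgebra K A where
  antipode : A →ₗ[K] A
  antipode_even : ∀ a ∈ A₀, antipode a ∈ A₀
  antipode_odd : ∀ a ∈ A₁, antipode a ∈ A₁
  antipode_left : ∀ a : A,
    LinearMap.mul' K A (TensorProduct.map antipode (LinearMap.id : A →ₗ[K] A) (Δ a)) =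
      algebraMap K A (ε a)
  antipode_right : ∀ a : A,
    LinearMap.mul' K A (TensorProduct.map (LinearMap.id : A →ₗ[K] A) antipode (Δ a)) =
      algebraMap K A (ε a)

end SuperDefs


/-- the exterior superalgebra `K⟨x,y⟩/(x², y², xy + yx)` with even part
`span{1, x}` and odd part `span{y, xy}` admits no superbialgebra structure. -/
theorem exterior_algebra_mixed_grading_admits_no_superbialgebra
    {K A : Type*} [Field K] [IsAlgClosed K] [CharZero K] [Ring A] [Algebra K A]
    (B : SuperBialgebra K A) (x y : A)
    (hx : x * x = 0) (hy : y * y = 0) (hxy : x * y + y * x = 0)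
    (hind : LinearIndependent K ![(1 : A), x, y, x * y])
    (h0 : B.A₀ = Submodule.span K {1, x})
    (h1 : B.A₁ = Submodule.span K {y, x * y}) :
    False := by
  have hyx : y * x = -(x * y) := by rw [eq_neg_iff_add_eq_zero, add_comm]; exact hxy
  have hxxy : x * (x * y) = 0 := by rw [← mul_assoc, hx, zero_mul]
  have hyxy : y * (x * y) = 0 := by rw [← mul_assoc, hyx, neg_mul, mul_assoc, hy]; simp
  have hspan : ⊤ ≤ Submodule.span K (Set.range ![(1 : A), x, y, x * y]) := by
    rw [← B.compl.sup_eq_top, h0, h1, ← Submodule.span_union]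
    apply Submodule.span_mono
    rintro z ((rfl | rfl) | (rfl | rfl))
    · exact ⟨0, rfl⟩
    · exact ⟨1, rfl⟩
    · exact ⟨2, rfl⟩
    · exact ⟨3, rfl⟩
  let b := Module.Basis.mk hind hspan
  have hb : ∀ i, b i = ![(1 : A), x, y, x * y] i := fun i => Module.Basis.mk_apply hind hspan i
  obtain ⟨c, hc1, hcx, hcy, hcxy⟩ : ∃ c : A →ₗ[K] K, c 1 = 0 ∧ c x = 1 ∧ c y = 0 ∧
      c (x * y) = 0 := by
    refine ⟨b.coord 1, ?_, ?_, ?_, ?_⟩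
    · have := hb 0; simp only [Matrix.cons_val] at this; rw [← this]; simp
    · have := hb 1; simp only [Matrix.cons_val] at this; rw [← this]; simp
    · have := hb 2; simp only [Matrix.cons_val] at this; rw [← this]; simp
    · have := hb 3; simp only [Matrix.cons_val] at this; rw [← this]; simp
  have hex : B.ε x = 0 := by
    have := B.ε_mul x x
    rw [hx, map_zero] at this
    exact mul_self_eq_zero.mp this.symm
  have hey : B.ε y = 0 := B.ε_odd y (by rw [h1]; exact Submodule.subset_span (by simp))
  have he1 := B.ε_one
  have hder : ∀ u v, c (u * v) = c u * B.ε v + B.ε u * c v := by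
    have key : (LinearMap.mul K A).compr₂ c =
        (LinearMap.mul K K).compl₁₂ c B.ε + (LinearMap.mul K K).compl₁₂ B.ε c := by
      refine b.ext fun i => b.ext fun j => ?_
      rw [hb, hb]
      fin_cases i <;> fin_cases j <;>
        simp [hc1, hcx, hcy, hcxy, hex, hey, he1, B.ε_mul, hx, hy, hyx, hxxy, hyxy, mul_assoc]
    intro u v
    exact LinearMap.congr_fun₂ key u v
  have hc_odd : ∀ a ∈ B.A₁, c a = 0 := by
    intro a ha
    rw [h1, Submodule.mem_span_pair] at ha
    obtain ⟨r, s, rfl⟩ := ha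
    simp [hcy, hcxy]
  have hp1 : ∀ a, B.p₁ a ∈ B.A₁ := fun a => by simp [SuperAlgebra.p₁]
  have hp : ∀ a, B.p₀ a + B.p₁ a = a := fun a =>
    Submodule.projection_add_projection_eq_self B.compl a
  have hcp1 : ∀ a, c (B.p₁ a) = 0 := fun a => hc_odd _ (hp1 a)
  have hep1 : ∀ a, B.ε (B.p₁ a) = 0 := fun a => B.ε_odd _ (hp1 a)
  have hcp0 : ∀ a, c (B.p₀ a) = c a := fun a => by
    conv_rhs => rw [← hp a, map_add, hcp1, add_zero]
  have hep0 : ∀ a, B.ε (B.p₀ a) = B.ε a := fun a => by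
    conv_rhs => rw [← hp a, map_add, hep1, add_zero]
  let F : (A →ₗ[K] K) → (A →ₗ[K] K) → (A ⊗[K] A →ₗ[K] K) := fun f g =>
    LinearMap.mul' K K ∘ₗ TensorProduct.map f g
  have hF : ∀ f g a a', F f g (a ⊗ₜ a') = f a * g a' := fun f g a a' => by simp [F]
  have main : ∀ u v : A ⊗[K] A, F c c (B.superBimul (u ⊗ₜ v)) =
      F c c u * F B.ε B.ε v + F c B.ε u * F B.ε c v + F B.ε c u * F c B.ε v
        + F B.ε B.ε u * F c c v := by
    intro u v
    induction u with
    | zero => simp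
    | add u₁ u₂ h₁ h₂ => rw [TensorProduct.add_tmul]; simp only [map_add, h₁, h₂]; ring
    | tmul a a' =>
      induction v with
      | zero => simp
      | add u₁ u₂ h₁ h₂ => rw [TensorProduct.tmul_add]; simp only [map_add, h₁, h₂]; ring
      | tmul d d' =>
        simp [SuperAlgebra.superBimul, SuperAlgebra.rearr, SuperAlgebra.τ, hF,
          TensorProduct.add_tmul, TensorProduct.sub_tmul, TensorProduct.tmul_add,
          TensorProduct.tmul_sub, hder, hcp1, hep1, hcp0, hep0]
        ring
  have hL : ∀ g : A →ₗ[K] K, F B.ε g (B.Δ x) = g x := by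
    intro g
    have : F B.ε g = g ∘ₗ (TensorProduct.lid K A).toLinearMap ∘ₗ
        TensorProduct.map B.ε (LinearMap.id : A →ₗ[K] A) := by
      ext a a'; simp [F]
    rw [this]
    exact congrArg g (B.counit_left x)
  have hR : ∀ g : A →ₗ[K] K, F g B.ε (B.Δ x) = g x := by
    intro g
    have : F g B.ε = g ∘ₗ (TensorProduct.rid K A).toLinearMap ∘ₗ
        TensorProduct.map (LinearMap.id : A →ₗ[K] A) B.ε := by
      ext a a'; simp [F, mul_comm]
    rw [this]
    exact congrArg g (B.counit_right x)
  have h := main (B.Δ x) (B.Δ x)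
  rw [← B.Δ_mul, hx, map_zero, map_zero, hL, hL, hR, hex, hcx] at h
  norm_num at h
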